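/- Let (p,q) be Schrödinger-admissible with (p,q) ≠ (∞,2). Then there is no constant C > 0 with the following property: for every T > 0 and every smooth function u : [0,T]×ℝⁿ → ℂ whose support in the space variable is contained in a fixed compact subset of ℝⁿ∖{0}, one has ‖u‖_{L^p((0,T);L^q(ℝⁿ))} ≤ C(‖u(0,·)‖_{L²(ℝⁿ)} + ‖i∂_t u − Δu + 2iA·∇u + |A|²u‖_{L^{p'}((0,T);L^{q'}(ℝⁿ))}). In other words, solutions of the inhomogeneous magnetic Schrödinger equation i∂_t u + Hu = F with H = −(∇−iA)² = −Δ + 2iA·∇ + |A|² (A is divergence free) and magnetic potential A(x) = |x|^{−α}Mx, 1 < α < 2, cannot satisfy the Strichartz estimates. -/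

import Mathlib

open MeasureTheory Filter

noncomputable section

/-- Euclidean norm on `Fin m → ℝ`. -/
def euclNorm {m : ℕ} (y : Fin m → ℝ) : ℝ := Real.sqrt (∑ i, y i ^ 2)

/-- For even `m`, the `m × m` block-diagonal matrix with `m/2` diagonal blocks
`σ = ![![0,1],![-1,0]]`. -/
def omegaMat (m : ℕ) : Matrix (Fin m) (Fin m) ℝ := fun i j =>
  if i.val % 2 = 0 ∧ j.val = i.val + 1 then 1
  else if j.val % 2 = 0 ∧ i.val = j.val + 1 then -1
  else 0

/-- The `n × n` matrix whose upper-left `k × k` block is `Ω_k` and whose remaining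
entries vanish. -/
def Mmat (n k : ℕ) : Matrix (Fin n) (Fin n) ℝ := fun i j =>
  if i.val < k ∧ j.val < k then
    (if i.val % 2 = 0 ∧ j.val = i.val + 1 then 1
     else if j.val % 2 = 0 ∧ i.val = j.val + 1 then -1
     else 0)
  else 0

/-- `i`-th partial derivative of a function on `Fin m → ℝ`. -/
def pd {m : ℕ} (f : (Fin m → ℝ) → ℂ) (i : Fin m) (y : Fin m → ℝ) : ℂ :=
  fderiv ℝ f y (Pi.single i 1)

/-- Laplacian on `Fin m → ℝ`. -/
def lapV {m : ℕ} (f : (Fin m → ℝ) → ℂ) (y : Fin m → ℝ) : ℂ :=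
  ∑ i, pd (pd f i) i y

/-- Twisted Laplacian (Landau Hamiltonian)
`T v = -Δv + 2i (Ω_m y)·∇v + |y|² v` on `Fin m → ℝ`. -/
def twistedLap (m : ℕ) (f : (Fin m → ℝ) → ℂ) (y : Fin m → ℝ) : ℂ :=
  - lapV f y + 2 * Complex.I * ∑ i, (((omegaMat m).mulVec y i : ℝ) : ℂ) * pd f i y
    + ((euclNorm y ^ 2 : ℝ) : ℂ) * f y

/-- `L^q` norm (with real exponent) of a complex-valued function. -/
def LqNorm {X : Type*} [MeasureSpace X] (q : ℝ) (f : X → ℂ) : ℝ :=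
  (eLpNorm f (ENNReal.ofReal q) volume).toReal

/-- Mixed norm `‖u‖_{L^p((0,T);L^q)}`. -/
def mixedNorm {X : Type*} [MeasureSpace X] (p q T : ℝ) (u : ℝ → X → ℂ) : ℝ :=
  (∫ t in Set.Ioo (0:ℝ) T, LqNorm q (u t) ^ p) ^ (1/p)

/-- A smooth compactly supported cutoff `ψ` with `0 ≤ ψ ≤ 1`, `ψ s = 0` for `|s| > 1`
and `ψ s = 1` for `|s| < 1/2`. -/
def IsCutoff (ψ : ℝ → ℝ) : Prop :=
  ContDiff ℝ (⊤ : ℕ∞) ψ ∧ HasCompactSupport ψ ∧ (∀ s, 0 ≤ ψ s ∧ ψ s ≤ 1) ∧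
    (∀ s, 1 < |s| → ψ s = 0) ∧ (∀ s, |s| < 1/2 → ψ s = 1)

/-- `v` is a smooth nonzero eigenfunction of the twisted Laplacian on `Fin m → ℝ`
with eigenvalue `lam`, such that `v` and `∇v` lie in every `L^p`, `1 ≤ p < ∞`. -/
def IsEigen (m : ℕ) (lam : ℝ) (v : (Fin m → ℝ) → ℂ) : Prop :=
  ContDiff ℝ (⊤ : ℕ∞) v ∧ v ≠ 0 ∧ (∀ y, twistedLap m v y = (lam : ℂ) * v y) ∧
    (∀ p : ℝ, 1 ≤ p → MemLp v (ENNReal.ofReal p) volume) ∧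
    (∀ p : ℝ, 1 ≤ p → ∀ i, MemLp (pd v i) (ENNReal.ofReal p) volume)

/-- Schrödinger admissibility: `p, q ≥ 2` and `2/p = n/2 - n/q`. -/
def SAdmissible (n : ℕ) (p q : ℝ) : Prop :=
  2 ≤ p ∧ 2 ≤ q ∧ 2 / p = (n : ℝ) / 2 - (n : ℝ) / q

/-- The magnetic potential `A(x) = |x|^{-α} (Mmat n k) x` on `ℝⁿ`. -/
def Afield (n k : ℕ) (α : ℝ) (x : Fin n → ℝ) : Fin n → ℝ :=
  fun i => euclNorm x ^ (-α) * (Mmat n k).mulVec x i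

/-- Residual `i ∂_t u - Δu + 2i A·∇u + |A|² u` of the inhomogeneous magnetic
Schrödinger equation `i ∂_t u + H u = F`, `H = -Δ + 2iA·∇ + |A|²`, on `ℝⁿ`. -/
def schroedResid (n k : ℕ) (α : ℝ) (u : ℝ → (Fin n → ℝ) → ℂ) (t : ℝ)
    (x : Fin n → ℝ) : ℂ :=
  Complex.I * deriv (fun s => u s x) t - lapV (u t) x
    + 2 * Complex.I * ∑ i, ((Afield n k α x i : ℝ) : ℂ) * pd (u t) i x
    + ((euclNorm (Afield n k α x) ^ 2 : ℝ) : ℂ) * u t x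


/-! ### One-dimensional cutoff -/

def cutψ (s : ℝ) : ℝ := Real.smoothTransition (2 - 2 * s)

lemma cutψ_contDiff : ContDiff ℝ (⊤ : ℕ∞) cutψ := by
  unfold cutψ
  exact Real.smoothTransition.contDiff.comp (by fun_prop)

lemma cutψ_nonneg (s : ℝ) : 0 ≤ cutψ s := Real.smoothTransition.nonneg _
lemma cutψ_le_one (s : ℝ) : cutψ s ≤ 1 := Real.smoothTransition.le_one _
lemma cutψ_one {s : ℝ} (h : s ≤ 1/2) : cutψ s = 1 :=
  Real.smoothTransition.one_of_one_le (by linarith)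
lemma cutψ_zero {s : ℝ} (h : 1 ≤ s) : cutψ s = 0 :=
  Real.smoothTransition.zero_of_nonpos (by linarith)

lemma cutpsiD_contDiff : ContDiff ℝ (⊤ : ℕ∞) (deriv cutψ) := by
  have := cutψ_contDiff
  exact ((contDiff_infty_iff_deriv (𝕜 := ℝ)).1 this).2

lemma cutpsiDD_contDiff : ContDiff ℝ (⊤ : ℕ∞) (deriv (deriv cutψ)) :=
  ((contDiff_infty_iff_deriv (𝕜 := ℝ)).1 cutpsiD_contDiff).2

lemma bdd_of_zero_outside (f : ℝ → ℝ) (hf : Continuous f)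
    (h1 : ∀ s, s < 1/2 → f s = 0) (h2 : ∀ s, 1 < s → f s = 0) :
    ∃ K : ℝ, 0 ≤ K ∧ ∀ s, |f s| ≤ K := by
  obtain ⟨K, hK⟩ := (isCompact_Icc (a := (1/2:ℝ)) (b := 1)).exists_bound_of_continuousOn
    hf.continuousOn
  refine ⟨max K 0, le_max_right _ _, fun s => ?_⟩
  by_cases ha : s < 1/2
  · rw [h1 s ha]; simp
  by_cases hb : 1 < s
  · rw [h2 s hb]; simp
  exact (hK s ⟨not_lt.1 ha, not_lt.1 hb⟩).trans (le_max_left _ _)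

lemma cutpsiD_left (s : ℝ) (h : s < 1/2) : deriv cutψ s = 0 := by
  have : cutψ =ᶠ[nhds s] fun _ => 1 := by
    filter_upwards [Iio_mem_nhds h] with x hx using cutψ_one (le_of_lt hx)
  rw [this.deriv_eq]; simp

lemma cutpsiD_right (s : ℝ) (h : 1 < s) : deriv cutψ s = 0 := by
  have : cutψ =ᶠ[nhds s] fun _ => 0 := by
    filter_upwards [Ioi_mem_nhds h] with x hx using cutψ_zero (le_of_lt hx)
  rw [this.deriv_eq]; simp

lemma cutψ_bdd : ∃ K : ℝ, 0 ≤ K ∧ (∀ s, |deriv cutψ s| ≤ K) ∧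
    (∀ s, |deriv (deriv cutψ) s| ≤ K) := by
  obtain ⟨K1, h1, h1'⟩ := bdd_of_zero_outside _ cutpsiD_contDiff.continuous cutpsiD_left cutpsiD_right
  obtain ⟨K2, h2, h2'⟩ := bdd_of_zero_outside (deriv (deriv cutψ)) cutpsiDD_contDiff.continuous
    (fun s h => by
      have : deriv cutψ =ᶠ[nhds s] fun _ => 0 := by
        filter_upwards [Iio_mem_nhds h] with x hx using cutpsiD_left x hx
      rw [this.deriv_eq]; simp)
    (fun s h => by
      have : deriv cutψ =ᶠ[nhds s] fun _ => 0 := by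
        filter_upwards [Ioi_mem_nhds h] with x hx using cutpsiD_right x hx
      rw [this.deriv_eq]; simp)
  exact ⟨max K1 K2, h1.trans (le_max_left _ _), fun s => (h1' s).trans (le_max_left _ _),
    fun s => (h2' s).trans (le_max_right _ _)⟩

/-- profile -/
def hf (η s : ℝ) : ℝ := Real.exp (-s/2) * cutψ (η * s)
def hr1 (η s : ℝ) : ℝ := η * Real.exp (-s/2) * deriv cutψ (η * s)
def hr2 (η s : ℝ) : ℝ := - η * Real.exp (-s/2) * deriv cutψ (η * s)
  + η^2 * Real.exp (-s/2) * deriv (deriv cutψ) (η * s)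

lemma hf_contDiff (η : ℝ) : ContDiff ℝ (⊤ : ℕ∞) (hf η) := by
  unfold hf
  exact (Real.contDiff_exp.comp (by fun_prop)).mul (cutψ_contDiff.comp (by fun_prop))

lemma exp_hasDeriv (s : ℝ) : HasDerivAt (fun s : ℝ => Real.exp (-s/2))
    (Real.exp (-s/2) * (-1/2)) s :=
  (((hasDerivAt_id s).neg).div_const 2).exp

lemma comp_hasDeriv (η s : ℝ) (f : ℝ → ℝ) (hf : ContDiff ℝ (⊤ : ℕ∞) f) :
    HasDerivAt (fun s => f (η * s)) (deriv f (η * s) * η) s := by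
  have h1 : HasDerivAt f (deriv f (η * s)) (η * s) :=
    (hf.differentiable (by simp)).differentiableAt.hasDerivAt
  have h2 : HasDerivAt (fun s : ℝ => η * s) η s := by
    simpa using (hasDerivAt_id s).const_mul η
  exact h1.comp s h2

lemma hf_deriv (η s : ℝ) : HasDerivAt (hf η) (-(1/2) * hf η s + hr1 η s) s := by
  have := (exp_hasDeriv s).mul (comp_hasDeriv η s cutψ cutψ_contDiff)
  refine this.congr_deriv ?_
  simp only [hf, hr1]; ring

lemma hf_deriv2 (η s : ℝ) : HasDerivAt (fun s => -(1/2) * hf η s + hr1 η s)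
    ((1/4) * hf η s + hr2 η s) s := by
  have h2 := (((exp_hasDeriv s).const_mul η).mul
    (comp_hasDeriv η s (deriv cutψ) cutpsiD_contDiff))
  have := ((hf_deriv η s).const_mul (-(1/2))).add h2
  refine this.congr_deriv ?_
  simp only [hf, hr1, hr2]; ring

lemma hr_bound {K : ℝ} (hK0 : 0 ≤ K) (hK1 : ∀ s, |deriv cutψ s| ≤ K)
    (hK2 : ∀ s, |deriv (deriv cutψ) s| ≤ K) (η s : ℝ) (h0 : 0 ≤ η) (h1 : η ≤ 1) :
    |hr1 η s| ≤ 2 * K * η * Real.exp (-s/2) ∧ |hr2 η s| ≤ 2 * K * η * Real.exp (-s/2) := by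
  have hE := (Real.exp_pos (-s/2)).le
  set E := Real.exp (-s/2) with hEd
  have e1 : |η * E * deriv cutψ (η * s)| ≤ K * η * E := by
    rw [abs_mul, abs_of_nonneg (by positivity)]
    nlinarith [hK1 (η * s), mul_nonneg h0 hE]
  have e2 : |η^2 * E * deriv (deriv cutψ) (η * s)| ≤ K * η * E := by
    rw [abs_mul, abs_of_nonneg (by positivity)]
    calc η^2 * E * _ ≤ η^2 * E * K := by gcongr; exact hK2 _
      _ ≤ η * E * K := by gcongr; nlinarith
      _ = _ := by ring
  have hpos : 0 ≤ K * η * E := by positivity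
  constructor
  · unfold hr1; linarith
  · unfold hr2
    calc _ ≤ |- η * E * deriv cutψ (η * s)| + |η^2 * E * deriv (deriv cutψ) (η * s)| :=
          abs_add_le _ _
      _ ≤ _ := by
        rw [neg_mul, neg_mul, abs_neg]; linarith

/-! ### Quadratic form and derivatives -/

def QQ {n : ℕ} (s c x : Fin n → ℝ) : ℝ := ∑ i, ((x i - c i) / s i) ^ 2

lemma QQ_contDiff {n : ℕ} (s c : Fin n → ℝ) : ContDiff ℝ (⊤ : ℕ∞) (QQ s c) := by
  unfold QQ
  fun_prop

lemma QQ_fderiv {n : ℕ} (s c x : Fin n → ℝ) (i : Fin n) :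
    fderiv ℝ (QQ s c) x (Pi.single i 1) = 2 * (x i - c i) / s i ^ 2 := by
  have h : HasFDerivAt (QQ s c) (∑ j, (2 * ((x j - c j) / s j) * (1 / s j)) •
      (ContinuousLinearMap.proj (R := ℝ) (φ := fun _ : Fin n => ℝ) j)) x := by
    unfold QQ
    refine HasFDerivAt.fun_sum fun j _ => ?_
    have h1 : HasFDerivAt (fun y : Fin n → ℝ => y j)
      (ContinuousLinearMap.proj (R := ℝ) (φ := fun _ : Fin n => ℝ) j) x := hasFDerivAt_apply j x
    have h2 : HasDerivAt (fun r : ℝ => ((r - c j) / s j)^2) 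
        (2 * ((x j - c j) / s j) * (1 / s j)) (x j) := by
      have := (((hasDerivAt_id (x j)).sub_const (c j)).div_const (s j)).pow 2
      refine this.congr_deriv ?_
      simp
    exact h2.comp_hasFDerivAt x h1
  rw [h.fderiv]
  simp only [sum_apply, smul_apply,
    ContinuousLinearMap.proj_apply, smul_eq_mul, Pi.single_apply, mul_ite, mul_one, mul_zero]
  rw [Finset.sum_ite_eq']
  simp
  ring

lemma pd_real {n : ℕ} (z : ℂ) (G : (Fin n → ℝ) → ℝ) (x : Fin n → ℝ) (i : Fin n)
    (hG : DifferentiableAt ℝ G x) :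
    pd (fun x => z * (G x : ℂ)) i x = z * ((fderiv ℝ G x (Pi.single i 1) : ℝ) : ℂ) := by
  unfold pd
  have h1 : HasFDerivAt (fun x => ((G x : ℝ) : ℂ)) (Complex.ofRealCLM.comp (fderiv ℝ G x)) x :=
    (Complex.ofRealCLM.hasFDerivAt).comp x hG.hasFDerivAt
  have h2 := h1.const_mul z
  rw [h2.fderiv]
  simp

lemma fderiv_comp_QQ {n : ℕ} (s c x : Fin n → ℝ) (i : Fin n) (g : ℝ → ℝ) (gd : ℝ)
    (hg : HasDerivAt g gd (QQ s c x)) :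
    DifferentiableAt ℝ (fun x => g (QQ s c x)) x ∧
    fderiv ℝ (fun x => g (QQ s c x)) x (Pi.single i 1) = gd * (2 * (x i - c i) / s i ^ 2) := by
  have h1 : HasFDerivAt (QQ s c) (fderiv ℝ (QQ s c) x) x :=
    ((QQ_contDiff s c).differentiable (by simp)).differentiableAt.hasFDerivAt
  have h2 := hg.comp_hasFDerivAt x h1
  have h3 : HasFDerivAt (fun x => g (QQ s c x)) (gd • fderiv ℝ (QQ s c) x) x := h2
  refine ⟨h3.differentiableAt, ?_⟩
  rw [h3.fderiv]
  simp [QQ_fderiv]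

lemma pd1 {n : ℕ} (z : ℂ) (η : ℝ) (s c x : Fin n → ℝ) (i : Fin n) :
    pd (fun x => z * (hf η (QQ s c x) : ℂ)) i x =
      z * (((-(1/2) * hf η (QQ s c x) + hr1 η (QQ s c x)) * (2 * (x i - c i) / s i ^ 2) : ℝ) : ℂ) := by
  have h := fderiv_comp_QQ s c x i (hf η) _ (hf_deriv η _)
  rw [pd_real z (fun x => hf η (QQ s c x)) x i h.1, h.2]

lemma pd2 {n : ℕ} (z : ℂ) (η : ℝ) (s c x : Fin n → ℝ) (i : Fin n) :
    pd (pd (fun x => z * (hf η (QQ s c x) : ℂ)) i) i x =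
      z * ((((1/4) * hf η (QQ s c x) + hr2 η (QQ s c x)) * (2 * (x i - c i) / s i ^ 2)^2
        + (-(1/2) * hf η (QQ s c x) + hr1 η (QQ s c x)) * (2 / s i ^ 2) : ℝ) : ℂ) := by
  have e : pd (fun x => z * (hf η (QQ s c x) : ℂ)) i = fun x => 
      z * (((-(1/2) * hf η (QQ s c x) + hr1 η (QQ s c x)) * (2 * (x i - c i) / s i ^ 2) : ℝ) : ℂ) := by
    funext x; exact pd1 z η s c x i
  rw [e]
  have h := fderiv_comp_QQ s c x i _ _ (hf_deriv2 η (QQ s c x))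
  have h1 : HasFDerivAt (fun y : Fin n → ℝ => y i)
      (ContinuousLinearMap.proj (R := ℝ) (φ := fun _ : Fin n => ℝ) i) x := hasFDerivAt_apply i x
  have h2 : HasDerivAt (fun r : ℝ => 2 * (r - c i) / s i ^ 2) (2 / s i ^ 2) (x i) := by
    have := ((((hasDerivAt_id (x i)).sub_const (c i)).const_mul 2).div_const (s i ^ 2))
    refine this.congr_deriv ?_
    simp
  have h3' := h2.comp_hasFDerivAt x h1
  have h3 : HasFDerivAt (fun y : Fin n → ℝ => 2 * (y i - c i) / s i ^ 2)
    ((2 / s i ^ 2) • (ContinuousLinearMap.proj (R := ℝ) (φ := fun _ : Fin n => ℝ) i)) x := h3'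
  have h4 := h.1.hasFDerivAt.mul h3
  rw [pd_real z _ x i (by exact h4.differentiableAt)]
  congr 2
  have h5 := h4.fderiv
  have := congrArg (fun l => l (Pi.single i 1)) h5
  refine this.trans ?_
  simp only [add_apply, smul_apply, h.2, smul_eq_mul,
    ContinuousLinearMap.proj_apply, Pi.single_eq_same]
  ring

/-- the test function -/
def uu {n : ℕ} (θ η : ℝ) (s c : Fin n → ℝ) (t : ℝ) (x : Fin n → ℝ) : ℂ :=
  Complex.exp (Complex.I * (θ * t : ℝ)) * (hf η (QQ s c x) : ℂ)

lemma uu_contDiff {n : ℕ} (θ η : ℝ) (s c : Fin n → ℝ) :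
    ContDiff ℝ (⊤ : ℕ∞) (fun pr : ℝ × (Fin n → ℝ) => uu θ η s c pr.1 pr.2) := by
  unfold uu
  refine ContDiff.mul ?_ ?_
  · refine ContDiff.cexp ?_
    refine contDiff_const.mul ?_
    exact Complex.ofRealCLM.contDiff.comp (contDiff_const.mul contDiff_fst)
  · exact Complex.ofRealCLM.contDiff.comp ((hf_contDiff η).comp ((QQ_contDiff s c).comp contDiff_snd))

/-- real profile of the residual -/
def F0 {n : ℕ} (k : ℕ) (α θ η : ℝ) (s c x : Fin n → ℝ) : ℝ :=
  -θ * hf η (QQ s c x)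
  - ∑ i, (((1/4) * hf η (QQ s c x) + hr2 η (QQ s c x)) * (2 * (x i - c i) / s i ^ 2)^2
        + (-(1/2) * hf η (QQ s c x) + hr1 η (QQ s c x)) * (2 / s i ^ 2))
  + (euclNorm x ^ (-α))^2 * (∑ i, ((Mmat n k).mulVec x i)^2) * hf η (QQ s c x)

lemma resid_eq {n : ℕ} (k : ℕ) (α θ η : ℝ) (s c : Fin n → ℝ) (t : ℝ) (x : Fin n → ℝ)
    (hM : ∑ i, (Mmat n k).mulVec x i * ((x i - c i) / s i ^ 2) = 0) :
    schroedResid n k α (uu θ η s c) t x =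
      Complex.exp (Complex.I * (θ * t : ℝ)) * (F0 k α θ η s c x : ℂ) := by
  unfold schroedResid
  have hd : deriv (fun r => uu θ η s c r x) t = 
      Complex.I * θ * Complex.exp (Complex.I * (θ * t : ℝ)) * (hf η (QQ s c x) : ℂ) := by
    unfold uu
    have h1 : HasDerivAt (fun r : ℝ => ((θ * r : ℝ) : ℂ)) (θ : ℂ) t := by
      have := ((hasDerivAt_id t).const_mul θ).ofReal_comp
      simpa using this
    have := ((h1.const_mul Complex.I).cexp).mul_const ((hf η (QQ s c x) : ℂ))
    rw [this.deriv]; ring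
  have hl : lapV (uu θ η s c t) x = Complex.exp (Complex.I * (θ * t : ℝ)) * 
      ((∑ i, (((1/4) * hf η (QQ s c x) + hr2 η (QQ s c x)) * (2 * (x i - c i) / s i ^ 2)^2
        + (-(1/2) * hf η (QQ s c x) + hr1 η (QQ s c x)) * (2 / s i ^ 2)) : ℝ) : ℂ) := by
    unfold lapV
    rw [Complex.ofReal_sum, Finset.mul_sum]
    refine Finset.sum_congr rfl fun i _ => ?_
    exact pd2 _ η s c x i
  have hg : ∑ i, ((Afield n k α x i : ℝ) : ℂ) * pd (uu θ η s c t) i x = 0 := by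
    have : ∀ i, ((Afield n k α x i : ℝ) : ℂ) * pd (uu θ η s c t) i x = 
      Complex.exp (Complex.I * (θ * t : ℝ)) * 
       (((2 * euclNorm x ^ (-α) * (-(1/2) * hf η (QQ s c x) + hr1 η (QQ s c x))) *
        ((Mmat n k).mulVec x i * ((x i - c i) / s i ^ 2)) : ℝ) : ℂ) := by
      intro i
      have := pd1 (Complex.exp (Complex.I * (θ * t : ℝ))) η s c x i
      have hh : pd (uu θ η s c t) i x = _ := this
      rw [hh]
      unfold Afield
      push_cast
      ring
    rw [Finset.sum_congr rfl fun i _ => this i, ← Finset.mul_sum, ← Complex.ofReal_sum,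
      ← Finset.mul_sum, hM]
    simp
  have hA : euclNorm (Afield n k α x) ^ 2 = 
      (euclNorm x ^ (-α))^2 * (∑ i, ((Mmat n k).mulVec x i)^2) := by
    conv_lhs => unfold euclNorm
    rw [Real.sq_sqrt (Finset.sum_nonneg fun i _ => sq_nonneg _), Finset.mul_sum]
    refine Finset.sum_congr rfl fun i _ => ?_
    unfold Afield; ring
  rw [hd, hl, hg, hA]
  have hI := Complex.I_sq
  unfold F0 uu
  simp only [Complex.ofReal_add, Complex.ofReal_sub, Complex.ofReal_mul, Complex.ofReal_neg]
  linear_combination (θ * Complex.exp (Complex.I * (θ * t)) * (hf η (QQ s c x) : ℂ)) * hI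

/-! ### The matrix -/

lemma Mmat_antisymm (n k : ℕ) (i j : Fin n) : Mmat n k j i = - Mmat n k i j := by
  unfold Mmat
  split_ifs <;> first | omega | norm_num

lemma Mmat_dot (n k : ℕ) (x : Fin n → ℝ) : ∑ i, (Mmat n k).mulVec x i * x i = 0 := by
  have h : ∑ i, (Mmat n k).mulVec x i * x i = ∑ i, ∑ j, Mmat n k i j * x j * x i := by
    refine Finset.sum_congr rfl fun i _ => ?_
    rw [Matrix.mulVec, dotProduct, Finset.sum_mul]
  have h2 : ∑ i, ∑ j, Mmat n k i j * x j * x i = - ∑ i, ∑ j, Mmat n k i j * x j * x i := by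
    conv_lhs => rw [Finset.sum_comm]
    rw [← Finset.sum_neg_distrib]
    refine Finset.sum_congr rfl fun i _ => ?_
    rw [← Finset.sum_neg_distrib]
    refine Finset.sum_congr rfl fun j _ => ?_
    rw [Mmat_antisymm n k i j]; ring
  rw [h]; linarith

def tauF (n k : ℕ) (hk : k ≤ n) (hev : Even k) (i : Fin n) : Fin n :=
  if h : i.val < k then
    (if h2 : i.val % 2 = 0 then ⟨i.val + 1, by obtain ⟨r, hr⟩ := hev; omega⟩
      else ⟨i.val - 1, by omega⟩)
  else i

lemma tauF_lt (n k : ℕ) (hk : k ≤ n) (hev : Even k) (i : Fin n) :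
    (tauF n k hk hev i).val < k ↔ i.val < k := by
  obtain ⟨r, hr⟩ := hev
  unfold tauF
  split_ifs <;> simp <;> omega

lemma tauF_inv (n k : ℕ) (hk : k ≤ n) (hev : Even k) :
    Function.Involutive (tauF n k hk hev) := by
  intro i
  have hev' := hev
  obtain ⟨r, hr⟩ := hev'
  apply Fin.ext
  by_cases h : i.val < k
  · by_cases h2 : i.val % 2 = 0
    · have e : tauF n k hk hev i = ⟨i.val + 1, by omega⟩ := by simp [tauF, h, h2]
      rw [e]
      have h3 : i.val + 1 < k := by omega
      have h4 : ¬ (i.val + 1) % 2 = 0 := by omega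
      simp only [tauF, h3, h4, dif_pos, dif_neg, not_false_eq_true]
      simp
    · have e : tauF n k hk hev i = ⟨i.val - 1, by omega⟩ := by simp [tauF, h, h2]
      rw [e]
      have h3 : i.val - 1 < k := by omega
      have h4 : (i.val - 1) % 2 = 0 := by omega
      simp only [tauF, h3, h4, dif_pos]
      omega
  · simp [tauF, h]

lemma Mmat_mulVec_sq (n k : ℕ) (hk : k ≤ n) (hev : Even k) (x : Fin n → ℝ) (i : Fin n) :
    ((Mmat n k).mulVec x i)^2 = if i.val < k then (x (tauF n k hk hev i))^2 else 0 := by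
  have hl := tauF_lt n k hk hev i
  obtain ⟨r, hr⟩ := id hev
  rw [Matrix.mulVec, dotProduct]
  split_ifs with h
  · rw [Finset.sum_eq_single (tauF n k hk hev i)]
    · have : (Mmat n k i (tauF n k hk hev i))^2 = 1 := by
        unfold Mmat
        rw [if_pos ⟨h, hl.2 h⟩]
        by_cases h2 : i.val % 2 = 0
        · have e : tauF n k hk hev i = ⟨i.val + 1, by omega⟩ := by simp [tauF, h, h2]
          rw [e]; simp [h2]
        · have e : tauF n k hk hev i = ⟨i.val - 1, by omega⟩ := by simp [tauF, h, h2]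
          rw [e, if_neg (by simp [h2]), if_pos (by simp only; omega)]
          norm_num
      rw [mul_pow, this, one_mul]
    · intro j _ hj
      have : Mmat n k i j = 0 := by
        unfold Mmat
        by_cases h2 : i.val % 2 = 0
        · have e : tauF n k hk hev i = ⟨i.val + 1, by omega⟩ := by simp [tauF, h, h2]
          rw [e, Ne, Fin.ext_iff] at hj
          simp only at hj
          split_ifs <;> first | omega | rfl
        · have e : tauF n k hk hev i = ⟨i.val - 1, by omega⟩ := by simp [tauF, h, h2]
          rw [e, Ne, Fin.ext_iff] at hj
          simp only at hj
          split_ifs <;> first | omega | rfl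
      rw [this, zero_mul]
    · simp
  · rw [Finset.sum_eq_zero]
    · simp
    · intro j _
      simp [Mmat, h]

lemma Mmat_sq (n k : ℕ) (hk : k ≤ n) (hev : Even k) (x : Fin n → ℝ) :
    ∑ i, ((Mmat n k).mulVec x i)^2 = ∑ i : Fin n, if i.val < k then (x i)^2 else 0 := by
  rw [← Equiv.sum_comp ((tauF_inv n k hk hev).toPerm) (fun i : Fin n => if i.val < k then (x i)^2 else 0)]
  refine Finset.sum_congr rfl fun i _ => ?_
  rw [Mmat_mulVec_sq n k hk hev]
  simp only [Function.Involutive.coe_toPerm, tauF_lt]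

lemma Mmat_zero (n k : ℕ) (x : Fin n → ℝ) (i : Fin n) (h : ¬ i.val < k) :
    (Mmat n k).mulVec x i = 0 := by
  rw [Matrix.mulVec, dotProduct]
  refine Finset.sum_eq_zero fun j _ => ?_
  simp [Mmat, h]

/-- scales and center -/
def sc (n k : ℕ) (a b : ℝ) (i : Fin n) : ℝ := if i.val < k then a else b
def ce (n : ℕ) (R : ℝ) (i : Fin n) : ℝ := if i.val + 1 = n then R else 0

lemma sc_orth (n k : ℕ) (hk : k + 2 = n) (a b R : ℝ) (x : Fin n → ℝ) :
    ∑ i, (Mmat n k).mulVec x i * ((x i - ce n R i) / sc n k a b i ^ 2) = 0 := by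
  have : ∀ i, (Mmat n k).mulVec x i * ((x i - ce n R i) / sc n k a b i ^ 2) =
      (Mmat n k).mulVec x i * x i * (1 / a^2) := by
    intro i
    by_cases h : i.val < k
    · have h2 : ¬ (i.val + 1 = n) := by omega
      simp only [sc, ce, h, h2, if_true, if_false]; ring
    · rw [Mmat_zero n k x i h]; simp
  rw [Finset.sum_congr rfl fun i _ => this i, ← Finset.sum_mul, Mmat_dot, zero_mul]

/-! ### Geometry -/

lemma eucl_toLp {n : ℕ} (x : Fin n → ℝ) : euclNorm x = ‖WithLp.toLp 2 x‖ := by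
  rw [EuclideanSpace.norm_eq]
  simp [euclNorm]

lemma ce_norm (n : ℕ) (hn : 0 < n) (R : ℝ) (hR : 0 ≤ R) : euclNorm (ce n R) = R := by
  unfold euclNorm
  rw [Finset.sum_eq_single ⟨n-1, by omega⟩]
  · have : n - 1 + 1 = n := by omega
    simp [ce, this, Real.sqrt_sq hR]
  · intro j _ hj
    have : ¬ (j.val + 1 = n) := by
      intro h; apply hj; apply Fin.ext; simp; omega
    simp [ce, this]
  · simp

lemma eucl_diff (n k : ℕ) (hn : 0 < n) (a b R : ℝ) (hR : 0 ≤ R) (ha : 0 < a) (hab : a ≤ b)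
    (x : Fin n → ℝ) : |euclNorm x - R| ≤ b * Real.sqrt (QQ (sc n k a b) (ce n R) x) := by
  have hb : 0 < b := ha.trans_le hab
  have h1 : |euclNorm x - R| ≤ euclNorm (x - ce n R) := by
    conv_lhs => rw [← ce_norm n hn R hR]
    rw [eucl_toLp, eucl_toLp, eucl_toLp, WithLp.toLp_sub]
    exact abs_norm_sub_norm_le _ _
  refine h1.trans ?_
  have : b * Real.sqrt (QQ (sc n k a b) (ce n R) x) =
      Real.sqrt (b^2 * QQ (sc n k a b) (ce n R) x) := by
    rw [Real.sqrt_mul (sq_nonneg b), Real.sqrt_sq hb.le]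
  rw [this]
  unfold euclNorm QQ
  apply Real.sqrt_le_sqrt
  rw [Finset.mul_sum]
  refine Finset.sum_le_sum fun i _ => ?_
  have hs : 0 < sc n k a b i ∧ sc n k a b i ≤ b := by
    unfold sc; split_ifs <;> constructor <;> linarith
  rw [div_pow, Pi.sub_apply, mul_div_assoc', le_div_iff₀ (by have := hs.1; positivity)]
  have : sc n k a b i ^ 2 ≤ b^2 := by gcongr; exact hs.1.le; exact hs.2
  nlinarith [sq_nonneg (x i - ce n R i)]

/-- Lipschitz bound for `r ↦ r^(-2α)` near `R`. -/
lemma pow_lip (α : ℝ) (hα : 0 < α) : ∃ C : ℝ, 0 ≤ C ∧ ∀ R r : ℝ, 0 < R → |r - R| ≤ R / 2 →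
    |(r ^ (-α))^2 - (R^(-α))^2| ≤ C * (R^(-α))^2 * (|r - R| / R) := by
  have key : ∃ C : ℝ, 0 ≤ C ∧ ∀ y : ℝ, |y - 1| ≤ 1/2 → |(y^(-α))^2 - 1| ≤ C * |y - 1| := by
    have hd : ∀ y ∈ Set.Icc (1/2:ℝ) (3/2), HasDerivWithinAt (fun y : ℝ => y^(-2*α))
        (-2*α * y^(-2*α-1)) (Set.Icc (1/2:ℝ) (3/2)) y := by
      intro y hy
      have : y ≠ 0 := by have := hy.1; intro h; subst h; norm_num at this
      exact (Real.hasDerivAt_rpow_const (Or.inl this)).hasDerivWithinAt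
    have hc : ContinuousOn (fun y : ℝ => -2*α * y^(-2*α-1)) (Set.Icc (1/2:ℝ) (3/2)) := by
      refine continuousOn_const.mul (ContinuousOn.rpow_const continuousOn_id ?_)
      intro y hy
      left
      have h1 := hy.1; intro h; have h2 : y = 0 := h; subst h2; norm_num at h1
    obtain ⟨C, hC⟩ := isCompact_Icc.exists_bound_of_continuousOn hc
    have hC0 : 0 ≤ C := (norm_nonneg _).trans (hC 1 (by constructor <;> norm_num))
    refine ⟨C, hC0, fun y hy => ?_⟩
    rw [abs_le] at hy
    have hy' : y ∈ Set.Icc (1/2:ℝ) (3/2) := by constructor <;> linarith [hy.1, hy.2]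
    have := Convex.norm_image_sub_le_of_norm_hasDerivWithin_le hd hC (convex_Icc _ _)
      (x := 1) (y := y) (by constructor <;> norm_num) hy'
    simp only [Real.one_rpow, Real.norm_eq_abs] at this
    have e : (y^(-α))^2 = y^(-2*α) := by
      rw [← Real.rpow_natCast, ← Real.rpow_mul (by linarith [hy.1])]
      congr 1; push_cast; ring
    rw [e]; exact this
  obtain ⟨C, hC0, hC⟩ := key
  refine ⟨C, hC0, fun R r hR hr => ?_⟩
  have h1 : |r / R - 1| = |r - R| / R := by
    rw [← abs_of_pos hR, ← abs_div, abs_of_pos hR]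
    congr 1; field_simp
  have h2 := hC (r / R) (by rw [h1, div_le_iff₀ hR]; linarith)
  have hr0 : 0 ≤ r := by rw [abs_le] at hr; linarith [hr.1]
  have h3 : r ^ (-α) = (r/R)^(-α) * R^(-α) := by
    rw [← Real.mul_rpow (by positivity) hR.le]; congr 1; field_simp
  have h4 : |(r ^ (-α))^2 - (R^(-α))^2| = |((r/R) ^ (-α))^2 - 1| * (R^(-α))^2 := by
    rw [h3, ← abs_of_nonneg (sq_nonneg (R^(-α))), ← abs_mul, abs_of_nonneg (sq_nonneg (R^(-α)))]
    congr 1; ring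
  rw [h4, ← h1]
  calc _ ≤ (C * |r/R - 1|) * (R^(-α))^2 := by gcongr
    _ = _ := by ring

/-! ### Residual bound -/

lemma poly_exp (s : ℝ) (hs : 0 ≤ s) : (1 + s)^2 * Real.exp (-s/2) ≤ 64 * Real.exp (-(1/4) * s) := by
  have h1 : 1 + s ≤ 8 * Real.exp (s/8) := by
    have := Real.add_one_le_exp (s/8); linarith
  have h2 : (1+s)^2 ≤ 64 * Real.exp (s/4) := by
    have e : Real.exp (s/4) = Real.exp (s/8) ^ 2 := by
      rw [← Real.exp_nat_mul]; congr 1; push_cast; ring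
    rw [e]
    calc (1+s)^2 ≤ (8 * Real.exp (s/8))^2 := by gcongr
      _ = _ := by ring
  calc (1 + s)^2 * Real.exp (-s/2) ≤ 64 * Real.exp (s/4) * Real.exp (-s/2) := by gcongr
    _ = _ := by rw [mul_assoc, ← Real.exp_add]; congr 2; ring

def chi (n k : ℕ) (i : Fin n) : ℝ := if i.val < k then 1 else 0

lemma F0_formula (n k : ℕ) (hk : k + 2 = n) (hev : Even k) (α η a b R : ℝ) (ha : 0 < a) (hb : 0 < b)
    (x : Fin n → ℝ) :
    ∃ W1 W2 N2 : ℝ, 0 ≤ W1 ∧ 0 ≤ W2 ∧ 0 ≤ ∑ i, chi n k i ∧ 0 ≤ N2 ∧ (∑ i, chi n k i) + N2 = n ∧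
      W1 + W2 = QQ (sc n k a b) (ce n R) x ∧
      F0 k α ((∑ i, chi n k i) / a^2) η (sc n k a b) (ce n R) x =
        hf η (QQ (sc n k a b) (ce n R) x) * ((N2 - W2) / b^2 + a^2 * W1 * ((euclNorm x ^ (-α))^2 - 1/a^4))
        - 4 * hr2 η (QQ (sc n k a b) (ce n R) x) * (W1 / a^2 + W2 / b^2)
        - 2 * hr1 η (QQ (sc n k a b) (ce n R) x) * ((∑ i, chi n k i) / a^2 + N2 / b^2) := by
  have hχ : ∀ i, 0 ≤ chi n k i ∧ chi n k i ≤ 1 := by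
    intro i; unfold chi; split_ifs <;> norm_num
  set w : Fin n → ℝ := fun i => ((x i - ce n R i) / sc n k a b i)^2 with hw
  have hw0 : ∀ i, 0 ≤ w i := fun i => sq_nonneg _
  refine ⟨∑ i, chi n k i * w i, ∑ i, (1 - chi n k i) * w i, ∑ i, (1 - chi n k i),
    Finset.sum_nonneg fun i _ => mul_nonneg (hχ i).1 (hw0 i),
    Finset.sum_nonneg fun i _ => mul_nonneg (by linarith [(hχ i).2]) (hw0 i),
    Finset.sum_nonneg fun i _ => (hχ i).1,
    Finset.sum_nonneg fun i _ => by linarith [(hχ i).2], ?_, ?_, ?_⟩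
  · rw [← Finset.sum_add_distrib]; simp
  · rw [← Finset.sum_add_distrib]; unfold QQ
    refine Finset.sum_congr rfl fun i _ => ?_
    rw [hw]; ring
  · unfold F0
    rw [Mmat_sq n k (by omega) hev]
    have hY : (∑ i : Fin n, if i.val < k then (x i)^2 else 0) = a^2 * ∑ i, chi n k i * w i := by
      rw [Finset.mul_sum]
      refine Finset.sum_congr rfl fun i _ => ?_
      by_cases h : i.val < k
      · have h2 : ¬ (i.val + 1 = n) := by omega
        simp only [hw, sc, ce, chi, h, h2, if_true, if_false]
        field_simp; ring
      · simp [chi, h]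
    rw [hY]
    set Q := QQ (sc n k a b) (ce n R) x
    have hS : ∑ i, (((1/4) * hf η Q + hr2 η Q) * (2 * (x i - ce n R i) / sc n k a b i ^ 2)^2
        + (-(1/2) * hf η Q + hr1 η Q) * (2 / sc n k a b i ^ 2)) =
        ((1/4) * hf η Q + hr2 η Q) * 4 * ((∑ i, chi n k i * w i) / a^2 +
          (∑ i, (1 - chi n k i) * w i) / b^2) +
        (-(1/2) * hf η Q + hr1 η Q) * 2 * ((∑ i, chi n k i) / a^2 +
          (∑ i, (1 - chi n k i)) / b^2) := by
      simp only [Finset.sum_div]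
      simp only [← Finset.sum_add_distrib, Finset.mul_sum]
      refine Finset.sum_congr rfl fun i _ => ?_
      by_cases h : i.val < k
      · simp only [hw, sc, chi, h, if_true]; field_simp; ring
      · simp only [hw, sc, chi, h, if_false]; field_simp; ring
    rw [hS]
    field_simp
    ring

lemma tri_aux (A r P r2 P2 : ℝ) : |A - 4 * r * P - 2 * r2 * P2| ≤
    |A| + 4 * |r * P| + 2 * |r2 * P2| := by
  have e : A - 4 * r * P - 2 * r2 * P2 = A - 4 * (r * P) - 2 * (r2 * P2) := by ring
  rw [e]
  have h1 := abs_le.1 (le_refl |A|)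
  have h2 := abs_le.1 (le_refl |r * P|)
  have h3 := abs_le.1 (le_refl |r2 * P2|)
  rw [abs_le]
  constructor <;> linarith [h1.1, h1.2, h2.1, h2.2, h3.1, h3.2]

set_option maxHeartbeats 1000000 in
lemma F0_bound (n k : ℕ) (hk : k + 2 = n) (hev : Even k) (α : ℝ) (hα : 0 < α) :
    ∃ D : ℝ, 0 ≤ D ∧ ∀ a b R ρ : ℝ, 2 ≤ ρ → 0 < a → b = a * ρ → R = a * ρ^3 →
      R ^ (-α) = 1 / a^2 → ∀ x : Fin n → ℝ,
      |F0 k α ((∑ i, chi n k i) / a^2) (4/ρ^4) (sc n k a b) (ce n R) x| ≤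
        D / b^2 * Real.exp (-(1/4) * QQ (sc n k a b) (ce n R) x) := by
  obtain ⟨K, hK0, hK1, hK2⟩ := cutψ_bdd
  obtain ⟨C, hC0, hC⟩ := pow_lip α hα
  refine ⟨64 * (n + 1 + C + 32 * K + 16 * K * n), by positivity, ?_⟩
  intro a b R ρ hρ ha hb hR hRa x
  have hρ0 : 0 < ρ := by linarith
  have hb0 : 0 < b := by rw [hb]; positivity
  have hR0 : 0 < R := by rw [hR]; positivity
  have hab : a ≤ b := by rw [hb]; nlinarith
  obtain ⟨W1, W2, N2, hW1, hW2, hN1, hN2, hN, hW, hF⟩ := F0_formula n k hk hev α (4/ρ^4) a b R ha hb0 x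
  rw [hF]
  have hdist := eucl_diff n k (by omega) a b R hR0.le ha hab x
  set N1 := ∑ i, chi n k i
  set s := QQ (sc n k a b) (ce n R) x with hs
  set E := Real.exp (-s/2) with hE
  have hE0 : 0 < E := Real.exp_pos _
  have hs0 : 0 ≤ s := by rw [← hW]; positivity
  have hn0 : (0:ℝ) ≤ n := Nat.cast_nonneg n
  have hη0 : 0 ≤ 4/ρ^4 := by positivity
  have hρ4 : (16:ℝ) ≤ ρ^4 := by
    calc (16:ℝ) = 2^4 := by norm_num
      _ ≤ ρ^4 := by gcongr
  have hη1 : 4/ρ^4 ≤ 1 := by rw [div_le_one (by positivity)]; linarith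
  obtain ⟨hr1b, hr2b⟩ := hr_bound hK0 hK1 hK2 (4/ρ^4) s hη0 hη1
  have hηb : 4/ρ^4 * (1/a^2) ≤ 4 / b^2 := by
    rw [hb]
    have : 4/ρ^4 * (1/a^2) = 4/(a*ρ)^2 * (1/ρ^2) := by field_simp
    rw [this]
    have h2 : 1/ρ^2 ≤ 1 := by rw [div_le_one (by positivity)]; nlinarith
    exact mul_le_of_le_one_right (by positivity) h2
  have hinv : 1/b^2 ≤ 1/a^2 := by gcongr
  have rb : ∀ (r P1 P2 : ℝ), |r| ≤ 2 * K * (4/ρ^4) * E → 0 ≤ P1 → 0 ≤ P2 →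
      |r * (P1 / a^2 + P2 / b^2)| ≤ 8 * K * E * (P1 + P2) / b^2 := by
    intro r P1 P2 hr h1 h2
    have hle : P1 / a^2 + P2 / b^2 ≤ (P1 + P2) * (1/a^2) := by
      have : P2 / b^2 ≤ P2 * (1/a^2) := by
        rw [div_eq_mul_one_div]; gcongr
      calc _ ≤ P1 / a^2 + P2 * (1/a^2) := by linarith
        _ = _ := by ring
    rw [abs_mul, abs_of_nonneg (a := P1 / a^2 + P2 / b^2) (by positivity)]
    calc _ ≤ (2 * K * (4/ρ^4) * E) * ((P1 + P2) * (1/a^2)) := by gcongr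
      _ = 2 * K * E * (P1 + P2) * (4/ρ^4 * (1/a^2)) := by ring
      _ ≤ 2 * K * E * (P1 + P2) * (4 / b^2) := by gcongr
      _ = _ := by ring
  have b2 := rb _ W1 W2 hr2b hW1 hW2
  have b1 := rb _ N1 N2 hr1b hN1 hN2
  rw [hW] at b2
  rw [hN] at b1
  have hsqrt : Real.sqrt s ≤ 1 + s := by
    rw [Real.sqrt_le_left (by linarith)]; nlinarith
  have hh0 : 0 ≤ hf (4/ρ^4) s := mul_nonneg hE0.le (cutψ_nonneg _)
  have hhE : hf (4/ρ^4) s ≤ E := by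
    unfold hf; exact mul_le_of_le_one_right hE0.le (cutψ_le_one _)
  have b0 : |hf (4/ρ^4) s * ((N2 - W2) / b^2 + a^2 * W1 * ((euclNorm x ^ (-α))^2 - 1/a^4))| ≤
      E * ((n + s) + C * (s * Real.sqrt s)) / b^2 := by
    by_cases hcut : 1 ≤ 4/ρ^4 * s
    · have : hf (4/ρ^4) s = 0 := by unfold hf; rw [cutψ_zero hcut, mul_zero]
      rw [this]; simp; positivity
    · push Not at hcut
      have hss : s ≤ (ρ^2/2)^2 := by
        have : 4/ρ^4 * s = s / (ρ^2/2)^2 := by field_simp; ring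
        rw [this, div_lt_one (by positivity)] at hcut
        exact hcut.le
      have hsq : Real.sqrt s ≤ ρ^2/2 := by
        rw [Real.sqrt_le_left (by positivity)]; exact hss
      have hd2 : |euclNorm x - R| ≤ R / 2 := by
        refine hdist.trans ?_
        calc b * Real.sqrt s ≤ b * (ρ^2/2) := by gcongr
          _ = R/2 := by rw [hb, hR]; ring
      have hl := hC R (euclNorm x) hR0 hd2
      have e4 : (R^(-α))^2 = 1/a^4 := by rw [hRa]; field_simp
      rw [e4] at hl
      have hl2 : |(euclNorm x ^ (-α))^2 - 1/a^4| ≤ C * (1/a^4) * (b * Real.sqrt s / R) := by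
        refine hl.trans ?_
        gcongr
      have e5 : a^2 * s * (C * (1/a^4) * (b * Real.sqrt s / R)) = C * (s * Real.sqrt s) / b^2 := by
        rw [hb, hR]; field_simp
      have t1 : |(N2 - W2) / b^2| ≤ (n + s) / b^2 := by
        rw [abs_div, abs_of_pos (a := b^2) (by positivity)]
        gcongr
        rw [abs_le]; constructor <;> linarith
      have t2 : |a^2 * W1 * ((euclNorm x ^ (-α))^2 - 1/a^4)| ≤ C * (s * Real.sqrt s) / b^2 := by
        rw [abs_mul, abs_of_nonneg (a := a^2 * W1) (by positivity), ← e5]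
        gcongr
        linarith
      rw [abs_mul, abs_of_nonneg hh0]
      calc _ ≤ E * ((n + s) / b^2 + C * (s * Real.sqrt s) / b^2) := by
            gcongr
            exact (abs_add_le _ _).trans (add_le_add t1 t2)
        _ = _ := by ring
  have tot : |hf (4/ρ^4) s * ((N2 - W2) / b^2 + a^2 * W1 * ((euclNorm x ^ (-α))^2 - 1/a^4))
        - 4 * hr2 (4/ρ^4) s * (W1 / a^2 + W2 / b^2)
        - 2 * hr1 (4/ρ^4) s * (N1 / a^2 + N2 / b^2)| ≤
      E * ((n + s) + C * (s * Real.sqrt s)) / b^2 + 4 * (8 * K * E * s / b^2)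
        + 2 * (8 * K * E * n / b^2) := by
    exact (tri_aux _ _ _ _ _).trans (by linarith)
  refine tot.trans ?_
  have hp := poly_exp s hs0
  have h1s : 1 ≤ (1+s)^2 := by nlinarith
  have h2s : s ≤ (1+s)^2 := by nlinarith
  have h3s : s * Real.sqrt s ≤ (1+s)^2 := by nlinarith
  calc _ = E / b^2 * (n * 1 + s + C * (s * Real.sqrt s) + 32 * K * s + 16 * K * n * 1) := by ring
    _ ≤ E / b^2 * (n * (1+s)^2 + (1+s)^2 + C * (1+s)^2 + 32 * K * (1+s)^2
          + 16 * K * n * (1+s)^2) := by gcongr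
    _ = (n + 1 + C + 32 * K + 16 * K * n) / b^2 * ((1+s)^2 * E) := by ring
    _ ≤ (n + 1 + C + 32 * K + 16 * K * n) / b^2 * (64 * Real.exp (-(1/4) * s)) := by gcongr
    _ = _ := by ring

/-! ### Norms -/

lemma gauss1 (κ s c : ℝ) (hκ : 0 < κ) (hs : 0 < s) :
    Integrable (fun x : ℝ => Real.exp (-κ * ((x - c) / s)^2)) ∧
    ∫ x : ℝ, Real.exp (-κ * ((x - c) / s)^2) = s * Real.sqrt (Real.pi / κ) := by
  have e : (fun x : ℝ => Real.exp (-κ * ((x - c) / s)^2)) =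
      fun x => (fun y => Real.exp (-(κ / s^2) * y^2)) (x - c) := by
    funext x; simp only; congr 1; field_simp
  have hp : 0 < κ / s^2 := by positivity
  constructor
  · rw [e]; exact (integrable_exp_neg_mul_sq hp).comp_sub_right c
  · rw [e, integral_sub_right_eq_self (fun y => Real.exp (-(κ / s^2) * y^2)) c, integral_gaussian]
    have : Real.pi / (κ / s^2) = s^2 * (Real.pi / κ) := by field_simp
    rw [this, Real.sqrt_mul (sq_nonneg s), Real.sqrt_sq hs.le]

lemma gaussn {n : ℕ} (κ : ℝ) (hκ : 0 < κ) (s c : Fin n → ℝ) (hs : ∀ i, 0 < s i) :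
    Integrable (fun x : Fin n → ℝ => Real.exp (-κ * QQ s c x)) ∧
    ∫ x : Fin n → ℝ, Real.exp (-κ * QQ s c x) = (∏ i, s i) * Real.sqrt (Real.pi / κ) ^ n := by
  have e : (fun x : Fin n → ℝ => Real.exp (-κ * QQ s c x)) =
      fun x => ∏ i, (fun i (y : ℝ) => Real.exp (-κ * ((y - c i) / s i)^2)) i (x i) := by
    funext x
    rw [← Real.exp_sum]; congr 1
    unfold QQ; rw [Finset.mul_sum]
  constructor
  · rw [e]
    exact Integrable.fintype_prod (f := fun i (y : ℝ) => Real.exp (-κ * ((y - c i) / s i)^2))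
      (fun i => (gauss1 κ (s i) (c i) hκ (hs i)).1)
  · rw [e]
    rw [integral_fintype_prod_volume_eq_prod (fun i (y : ℝ) => Real.exp (-κ * ((y - c i) / s i)^2))]
    rw [Finset.prod_congr rfl fun i _ => (gauss1 κ (s i) (c i) hκ (hs i)).2]
    rw [Finset.prod_mul_distrib]; simp

lemma gauss_norm (n : ℕ) (κ r : ℝ) (hκ : 0 < κ) (hr : 1 ≤ r) : ∃ C : ℝ, 0 ≤ C ∧
    ∀ (s c : Fin n → ℝ), (∀ i, 0 < s i) → ∀ (D : ℝ), 0 ≤ D → ∀ f : (Fin n → ℝ) → ℂ,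
      (∀ x, ‖f x‖ ≤ D * Real.exp (-κ * QQ s c x)) →
      eLpNorm f (ENNReal.ofReal r) volume ≤ ENNReal.ofReal (D * (C * (∏ i, s i) ^ (1/r))) := by
  have hr0 : 0 < r := by linarith
  refine ⟨(Real.sqrt (Real.pi / (r * κ)) ^ n) ^ (1/r), by positivity, ?_⟩
  intro s c hs D hD f hf
  have h1 : eLpNorm f (ENNReal.ofReal r) volume ≤
      eLpNorm (fun x => D * Real.exp (-κ * QQ s c x)) (ENNReal.ofReal r) volume :=
    eLpNorm_mono_real hf
  refine h1.trans ?_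
  have h2 : eLpNorm (fun x => D * Real.exp (-κ * QQ s c x)) (ENNReal.ofReal r) volume =
      ENNReal.ofReal D * eLpNorm (fun x => Real.exp (-κ * QQ s c x)) (ENNReal.ofReal r) volume := by
    have := eLpNorm_const_smul D (fun x => Real.exp (-κ * QQ s c x)) (ENNReal.ofReal r) volume
    rw [Real.enorm_of_nonneg hD] at this
    exact this
  rw [h2, ENNReal.ofReal_mul hD]
  gcongr
  rw [eLpNorm_eq_lintegral_rpow_enorm_toReal (by simpa using hr0) (by simp),
    ENNReal.toReal_ofReal hr0.le]
  have hJ : 0 ≤ ∏ i, s i := Finset.prod_nonneg fun i _ => (hs i).le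
  rw [← Real.mul_rpow (by positivity) hJ, ← ENNReal.ofReal_rpow_of_nonneg (by positivity) (by positivity)]
  gcongr
  obtain ⟨g1, g2⟩ := gaussn (r * κ) (by positivity) s c hs
  rw [mul_comm, ← g2, ofReal_integral_eq_lintegral_ofReal g1 (ae_of_all _ fun x => (Real.exp_pos _).le)]
  refine le_of_eq (lintegral_congr fun x => ?_)
  rw [Real.enorm_of_nonneg (Real.exp_pos _).le, ENNReal.ofReal_rpow_of_pos (Real.exp_pos _),
    ← Real.exp_mul]
  congr 2; ring

lemma box_norm (n : ℕ) (r : ℝ) (hr : 1 ≤ r) (s c : Fin n → ℝ) (hs : ∀ i, 0 < s i) (D : ℝ) (hD : 0 ≤ D)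
    (f : (Fin n → ℝ) → ℂ) (hf : ∀ x, QQ s c x ≤ n → D ≤ ‖f x‖) :
    ENNReal.ofReal (D * (∏ i, s i) ^ (1/r)) ≤ eLpNorm f (ENNReal.ofReal r) volume := by
  have hr0 : 0 < r := by linarith
  set B : Set (Fin n → ℝ) := Set.Icc (fun i => c i - s i) (fun i => c i + s i) with hB
  have h1 : eLpNorm (B.indicator fun _ => D) (ENNReal.ofReal r) volume ≤
      eLpNorm f (ENNReal.ofReal r) volume := by
    refine eLpNorm_mono fun x => ?_
    by_cases hx : x ∈ B
    · rw [Set.indicator_of_mem hx, Real.norm_of_nonneg hD]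
      apply hf
      unfold QQ
      calc _ ≤ ∑ i : Fin n, (1:ℝ) := by
            refine Finset.sum_le_sum fun i _ => ?_
            have h1 := hx.1 i
            have h2 := hx.2 i
            simp only at h1 h2
            rw [sq_le_one_iff_abs_le_one, abs_le, le_div_iff₀ (hs i), div_le_iff₀ (hs i)]
            constructor <;> linarith
        _ = n := by simp
    · rw [Set.indicator_of_notMem hx]; simp
  refine le_trans ?_ h1
  rw [eLpNorm_indicator_const measurableSet_Icc (by simpa using hr0) (by simp),
    ENNReal.toReal_ofReal hr0.le, Real.enorm_of_nonneg hD, ENNReal.ofReal_mul hD]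
  have hJ : 0 ≤ ∏ i, s i := Finset.prod_nonneg fun i _ => (hs i).le
  gcongr
  rw [← ENNReal.ofReal_rpow_of_nonneg hJ (by positivity)]
  gcongr
  rw [Real.volume_Icc_pi, ENNReal.ofReal_prod_of_nonneg (fun i _ => (hs i).le)]
  refine Finset.prod_le_prod' fun i _ => ?_
  apply ENNReal.ofReal_le_ofReal
  have := hs i
  linarith

lemma mixed_const {X : Type*} [MeasureSpace X] (p q T N : ℝ) (hp : 0 < p) (hT : 0 < T) (hN : 0 ≤ N)
    (u : ℝ → X → ℂ) (h : ∀ t, LqNorm q (u t) = N) : mixedNorm p q T u = T^(1/p) * N := by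
  unfold mixedNorm
  simp only [h]
  rw [setIntegral_const]
  simp only [measureReal_def, Real.volume_Ioo, sub_zero, ENNReal.toReal_ofReal hT.le, smul_eq_mul]
  rw [Real.mul_rpow hT.le (by positivity), ← Real.rpow_mul hN, mul_one_div_cancel hp.ne', Real.rpow_one]

lemma prod_sc (n k : ℕ) (hk : k + 2 = n) (a b : ℝ) : ∏ i, sc n k a b i = a^k * b^2 := by
  subst hk
  rw [Fin.prod_univ_castSucc, Fin.prod_univ_castSucc]
  simp [sc]
  ring

lemma norm_phase (θ t : ℝ) (z : ℂ) : ‖Complex.exp (Complex.I * (θ * t : ℝ)) * z‖ = ‖z‖ := by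
  rw [norm_mul, mul_comm Complex.I, Complex.norm_exp_ofReal_mul_I, one_mul]

lemma LqNorm_congr {n : ℕ} (q : ℝ) (f g : (Fin n → ℝ) → ℂ) (h : ∀ x, ‖f x‖ = ‖g x‖) :
    LqNorm q f = LqNorm q g := by
  unfold LqNorm
  rw [eLpNorm_congr_norm_ae (ae_of_all _ h)]

/-! ### Support -/

lemma QQ_compact {n : ℕ} (s c : Fin n → ℝ) (hs : ∀ i, 0 < s i) (M : ℝ) :
    IsCompact {x | QQ s c x ≤ M} := by
  have hcl : IsClosed {x | QQ s c x ≤ M} :=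
    isClosed_le (QQ_contDiff s c).continuous continuous_const
  refine IsCompact.of_isClosed_subset (isCompact_Icc
    (a := fun i => c i - s i * (1 + M)) (b := fun i => c i + s i * (1 + M))) hcl ?_
  intro x hx
  have hx' : QQ s c x ≤ M := hx
  have h : ∀ i, |(x i - c i) / s i| ≤ 1 + M := by
    intro i
    have h1 : ((x i - c i) / s i)^2 ≤ QQ s c x :=
      Finset.single_le_sum (f := fun i => ((x i - c i) / s i)^2) (fun j _ => sq_nonneg _)
        (Finset.mem_univ i)
    rw [← sq_abs] at h1
    nlinarith [abs_nonneg ((x i - c i) / s i), sq_nonneg (|(x i - c i) / s i| - 1)]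
  constructor <;> intro i <;> simp only <;> have h1 := h i <;>
    rw [abs_le, le_div_iff₀ (hs i), div_le_iff₀ (hs i)] at h1 <;> nlinarith [h1.1, h1.2]

/-- Everything about the test functions, with constants independent of the parameter. -/
lemma main_ineq (n k : ℕ) (hk : k + 2 = n) (hev : Even k) (α : ℝ) (hα1 : 1 < α) (hα2 : α < 2)
    (p q : ℝ) (hp : 2 ≤ p) (hq : 2 ≤ q) (C : ℝ) (hC : 0 < C)
    (H : ∀ T : ℝ, 0 < T → ∀ u : ℝ → (Fin n → ℝ) → ℂ,
        ContDiff ℝ (⊤ : ℕ∞) (fun pr : ℝ × (Fin n → ℝ) => u pr.1 pr.2) →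
        (∃ K : Set (Fin n → ℝ), IsCompact K ∧ (0 : Fin n → ℝ) ∉ K ∧
          ∀ t x, x ∉ K → u t x = 0) →
        mixedNorm p q T u ≤
          C * ((eLpNorm (u 0) 2 volume).toReal
            + mixedNorm (p / (p-1)) (q / (q-1)) T (schroedResid n k α u))) :
    ∃ c1 c2 c3 : ℝ, 0 < c1 ∧ 0 ≤ c2 ∧ 0 ≤ c3 ∧ ∀ ρ : ℝ, 2 ≤ ρ → 8 * n ≤ ρ → ∃ b J : ℝ, 0 < b ∧
      J = b ^ n * ρ ^ (-(k:ℝ)) ∧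
      (b^2)^(1/p) * (c1 * J ^ (1/q)) ≤ C * (c2 * J^((1:ℝ)/2) +
        (b^2)^(1/(p/(p-1))) * (c3 / b^2 * J ^ (1/(q/(q-1))))) := by
  have hp1 : 0 < p / (p-1) := div_pos (by linarith) (by linarith)
  have hq1 : 1 ≤ q / (q-1) := by rw [le_div_iff₀ (by linarith)]; linarith
  obtain ⟨Cq, hCq0, hCq⟩ := gauss_norm n (1/2) q (by norm_num) (by linarith)
  obtain ⟨C2, hC20, hC2⟩ := gauss_norm n (1/2) 2 (by norm_num) (by norm_num)
  obtain ⟨C3, hC30, hC3⟩ := gauss_norm n (1/4) (q/(q-1)) (by norm_num) hq1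
  obtain ⟨D, hD0, hD⟩ := F0_bound n k hk hev α (by linarith)
  refine ⟨Real.exp (-(n:ℝ)/2), C2, D * C3, Real.exp_pos _, hC20, by positivity, ?_⟩
  intro ρ hρ hρn
  have hρ0 : 0 < ρ := by linarith
  set a := ρ ^ (3 * α / (2 - α)) with ha_def
  have ha : 0 < a := Real.rpow_pos_of_pos hρ0 _
  set b := a * ρ with hb_def
  set R := a * ρ^3 with hR_def
  have hb : 0 < b := by positivity
  have hR : 0 < R := by positivity
  have hRα : R ^ (-α) = 1 / a^2 := by
    have e1 : R = ρ ^ (3 * α / (2 - α) + 3) := by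
      rw [Real.rpow_add hρ0, hR_def, ha_def]; norm_num
    have e2 : a^2 = ρ ^ (3 * α / (2 - α) * 2) := by
      rw [Real.rpow_mul hρ0.le, ← ha_def]; norm_num
    rw [e1, e2, ← Real.rpow_mul hρ0.le, one_div, ← Real.rpow_neg hρ0.le]
    congr 1
    have : 2 - α ≠ 0 := by linarith
    field_simp; ring
  set s := sc n k a b with hs_def
  set c := ce n R with hc_def
  have hs : ∀ i, 0 < s i := by
    intro i; rw [hs_def]; unfold sc; split_ifs <;> assumption
  set η := 4 / ρ^4 with hη
  set θ := (∑ i, chi n k i) / a^2 with hθ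
  have hDx := hD a b R ρ hρ ha rfl rfl hRα
  have hJ : ∏ i, s i = b ^ n * ρ ^ (-(k:ℝ)) := by
    rw [hs_def, prod_sc n k hk, ← hk, hb_def, Real.rpow_neg hρ0.le, Real.rpow_natCast]
    field_simp
    ring
  have hρ4 : ρ ≤ ρ^4 := le_self_pow₀ (by linarith) (by norm_num)
  have hn0 : (0:ℝ) ≤ n := Nat.cast_nonneg n
  -- pointwise bounds
  have hup : ∀ t x, ‖uu θ η s c t x‖ ≤ 1 * Real.exp (-(1/2) * QQ s c x) := by
    intro t x
    unfold uu
    rw [norm_phase, Complex.norm_real, Real.norm_eq_abs]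
    unfold hf
    rw [abs_of_nonneg (mul_nonneg (Real.exp_pos _).le (cutψ_nonneg _)), one_mul]
    refine (mul_le_of_le_one_right (Real.exp_pos _).le (cutψ_le_one _)).trans (le_of_eq ?_)
    congr 1; ring
  have hlow : ∀ t x, QQ s c x ≤ n → Real.exp (-(n:ℝ)/2) ≤ ‖uu θ η s c t x‖ := by
    intro t x hx
    unfold uu
    rw [norm_phase, Complex.norm_real, Real.norm_eq_abs]
    unfold hf
    rw [cutψ_one, mul_one, abs_of_pos (Real.exp_pos _)]
    · apply Real.exp_le_exp.2; linarith
    · calc η * QQ s c x ≤ η * n := by gcongr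
        _ ≤ 1/2 := by
          rw [hη, div_mul_eq_mul_div, div_le_iff₀ (by positivity)]; linarith
  have hres : ∀ t x, schroedResid n k α (uu θ η s c) t x =
      Complex.exp (Complex.I * (θ * t : ℝ)) * (F0 k α θ η s c x : ℂ) := fun t x =>
    resid_eq k α θ η s c t x (sc_orth n k hk a b R x)
  -- apply the estimate
  have hH := H (b^2) (by positivity) (uu θ η s c) (uu_contDiff θ η s c)
    ⟨{x | QQ s c x ≤ ρ^4/4}, QQ_compact s c hs _, ?_, ?_⟩
  · have hu : mixedNorm p q (b^2) (uu θ η s c) = (b^2)^(1/p) * LqNorm q (uu θ η s c 0) := by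
      refine mixed_const p q (b^2) _ (by linarith) (by positivity) ENNReal.toReal_nonneg _ ?_
      intro t
      refine LqNorm_congr q _ _ fun x => ?_
      unfold uu; rw [norm_phase, norm_phase]
    have hF : mixedNorm (p / (p-1)) (q / (q-1)) (b^2) (schroedResid n k α (uu θ η s c)) =
        (b^2)^(1/(p/(p-1))) * LqNorm (q/(q-1)) (schroedResid n k α (uu θ η s c) 0) := by
      refine mixed_const _ _ (b^2) _ hp1 (by positivity) ENNReal.toReal_nonneg _ ?_
      intro t
      refine LqNorm_congr _ _ _ fun x => ?_
      rw [hres, hres, norm_phase, norm_phase]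
    have B1 : Real.exp (-(n:ℝ)/2) * (∏ i, s i)^(1/q) ≤ LqNorm q (uu θ η s c 0) := by
      unfold LqNorm
      have hfin := hCq s c hs 1 zero_le_one _ (hup 0)
      rw [← ENNReal.ofReal_le_iff_le_toReal (ne_top_of_le_ne_top ENNReal.ofReal_ne_top hfin)]
      exact box_norm n q (by linarith) s c hs _ (Real.exp_pos _).le _ (hlow 0)
    have hJ0 : 0 ≤ ∏ i, s i := Finset.prod_nonneg fun i _ => (hs i).le
    have B2 : (eLpNorm (uu θ η s c 0) 2 volume).toReal ≤ C2 * (∏ i, s i)^((1:ℝ)/2) := by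
      have := hC2 s c hs 1 zero_le_one _ (hup 0)
      rw [ENNReal.ofReal_ofNat, one_mul] at this
      exact ENNReal.toReal_le_of_le_ofReal (by positivity) this
    have B3 : LqNorm (q/(q-1)) (schroedResid n k α (uu θ η s c) 0) ≤
        D * C3 / b^2 * (∏ i, s i)^(1/(q/(q-1))) := by
      have := hC3 s c hs (D / b^2) (by positivity) (schroedResid n k α (uu θ η s c) 0) (by
        intro x
        rw [hres, norm_phase, Complex.norm_real, Real.norm_eq_abs]
        exact hDx x)
      have h2 := ENNReal.toReal_le_of_le_ofReal (by positivity) this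
      refine h2.trans (le_of_eq ?_)
      ring
    refine ⟨b, ∏ i, s i, hb, hJ, ?_⟩
    rw [hu, hF] at hH
    calc _ ≤ (b^2)^(1/p) * LqNorm q (uu θ η s c 0) := by gcongr
      _ ≤ _ := hH
      _ ≤ _ := by gcongr
  · intro h0
    have h0' : QQ s c 0 ≤ ρ^4/4 := h0
    have h1 := eucl_diff n k (by omega) a b R hR.le ha (by rw [hb_def]; nlinarith) 0
    have h2 : Real.sqrt (QQ s c 0) ≤ ρ^2/2 := by
      rw [Real.sqrt_le_left (by positivity)]
      refine h0'.trans (le_of_eq (by ring))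
    have h3 : euclNorm (0 : Fin n → ℝ) = 0 := by simp [euclNorm]
    rw [h3, zero_sub, abs_neg, abs_of_pos hR] at h1
    have h4 : b * Real.sqrt (QQ s c 0) ≤ b * (ρ^2/2) := by gcongr
    have h5 : b * (ρ^2/2) = R / 2 := by rw [hb_def, hR_def]; ring
    have h6 : R ≤ b * Real.sqrt (QQ s c 0) := h1
    linarith
  · intro t x hx
    have hx' : ρ^4/4 < QQ s c x := not_le.1 hx
    unfold uu hf
    rw [cutψ_zero]
    · simp
    · rw [hη, div_mul_eq_mul_div, le_div_iff₀ (by positivity)]; linarith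

/-- Strichartz estimates fail for the magnetic Schrödinger equation with potential
`A(x) = |x|^{-α} M x`, `1 < α < 2`, in even dimension `n ≥ 4`. -/
theorem no_strichartz_even (n : ℕ) (hn : 4 ≤ n) (heven : Even n)
    (α : ℝ) (hα1 : 1 < α) (hα2 : α < 2)
    (p q : ℝ) (hpq : SAdmissible n p q) :
    ¬ ∃ C : ℝ, 0 < C ∧ ∀ T : ℝ, 0 < T → ∀ u : ℝ → (Fin n → ℝ) → ℂ,
        ContDiff ℝ (⊤ : ℕ∞) (fun pr : ℝ × (Fin n → ℝ) => u pr.1 pr.2) →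
        (∃ K : Set (Fin n → ℝ), IsCompact K ∧ (0 : Fin n → ℝ) ∉ K ∧
          ∀ t x, x ∉ K → u t x = 0) →
        mixedNorm p q T u ≤
          C * ((eLpNorm (u 0) 2 volume).toReal
            + mixedNorm (p / (p-1)) (q / (q-1)) T (schroedResid n (n-2) α u)) := by
  rintro ⟨C, hC, H⟩
  obtain ⟨k, hk⟩ : ∃ k, k + 2 = n := ⟨n - 2, by omega⟩
  have hk' : n - 2 = k := by omega
  rw [hk'] at H
  have hev : Even k := by
    obtain ⟨r, hr⟩ := heven
    exact ⟨r - 1, by omega⟩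
  obtain ⟨hp, hq, hadm⟩ := hpq
  have hk0 : (0:ℝ) < k := by
    have : 0 < k := by omega
    exact_mod_cast this
  have hn0 : (0:ℝ) < n := by
    have : 0 < n := by omega
    exact_mod_cast this
  have hq2 : 1 / q < 1 / 2 := by
    have h1 : 0 < 2 / p := by positivity
    rw [hadm] at h1
    have h2 : 0 < (n:ℝ) * (1/2 - 1/q) := by
      have e : (n:ℝ) * (1/2 - 1/q) = (n : ℝ) / 2 - (n : ℝ) / q := by ring
      rw [e]; exact h1
    have := pos_of_mul_pos_right h2 hn0.le
    linarith
  obtain ⟨c1, c2, c3, hc1, hc2, hc3, hmain⟩ :=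
    main_ineq n k hk hev α hα1 hα2 p q hp hq C hC H
  have key : ∀ ρ : ℝ, 2 ≤ ρ → 8 * n ≤ ρ → c1 ≤ C * (c2 * ρ ^ (-(k * (1/2 - 1/q))) +
      c3 * ρ ^ (-(k * (1 - 2 * (1/q))))) := by
    intro ρ h2 h8
    have hρ0 : 0 < ρ := by linarith
    obtain ⟨b, J, hb, hJ, hineq⟩ := hmain ρ h2 h8
    have eJ : ∀ e : ℝ, J ^ e = b ^ (n * e) * ρ ^ (-(k * e)) := by
      intro e
      rw [hJ, Real.mul_rpow (by positivity) (by positivity), ← Real.rpow_natCast,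
        ← Real.rpow_mul hb.le, ← Real.rpow_mul hρ0.le, neg_mul]
    have eb : ∀ e : ℝ, (b^2) ^ e = b ^ (2 * e) := by
      intro e
      rw [← Real.rpow_natCast, ← Real.rpow_mul hb.le]; norm_num
    have ep : 1 / (p / (p-1)) = 1 - 1/p := by
      have : p ≠ 0 := by linarith
      have : p - 1 ≠ 0 := by linarith
      field_simp
    have eqq : 1 / (q / (q-1)) = 1 - 1/q := by
      have : q ≠ 0 := by linarith
      have : q - 1 ≠ 0 := by linarith
      field_simp
    have eb2 : c3 / b^2 = c3 * b ^ (-2:ℝ) := by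
      rw [Real.rpow_neg hb.le, div_eq_mul_inv]; norm_num
    have hadm2 : 2 * (1/p) = n * (1/2) - n * (1/q) := by
      have e1 : 2 * (1/p) = 2 / p := by ring
      rw [e1, hadm]; ring
    rw [ep, eqq, eb2, eb, eb, eJ, eJ, eJ] at hineq
    set P := b ^ ((n:ℝ) * (1/2)) * ρ ^ (-(k * (1/q))) with hP
    have hP0 : 0 < P := by positivity
    have L : b ^ (2 * (1/p)) * (c1 * (b ^ ((n:ℝ) * (1/q)) * ρ ^ (-(k * (1/q))))) = P * c1 := by
      have : b ^ ((n:ℝ) * (1/2)) = b ^ (2 * (1/p)) * b ^ ((n:ℝ) * (1/q)) := by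
        rw [← Real.rpow_add hb]; congr 1; linarith
      rw [hP, this]; ring
    have R1 : c2 * (b ^ ((n:ℝ) * (1/2)) * ρ ^ (-(k * ((1:ℝ)/2)))) =
        P * (c2 * ρ ^ (-(k * (1/2 - 1/q)))) := by
      have : ρ ^ (-(k * ((1:ℝ)/2))) = ρ ^ (-(k * (1/q))) * ρ ^ (-(k * (1/2 - 1/q))) := by
        rw [← Real.rpow_add hρ0]; congr 1; ring
      rw [hP, this]; ring
    have R2 : b ^ (2 * (1 - 1/p)) * (c3 * b ^ (-2:ℝ) *
        (b ^ ((n:ℝ) * (1 - 1/q)) * ρ ^ (-(k * (1 - 1/q))))) =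
        P * (c3 * ρ ^ (-(k * (1 - 2 * (1/q))))) := by
      have h1 : ρ ^ (-(k * (1 - 1/q))) = ρ ^ (-(k * (1/q))) * ρ ^ (-(k * (1 - 2 * (1/q)))) := by
        rw [← Real.rpow_add hρ0]; congr 1; ring
      have h2 : b ^ ((n:ℝ) * (1/2)) =
          b ^ (2 * (1 - 1/p)) * b ^ (-2:ℝ) * b ^ ((n:ℝ) * (1 - 1/q)) := by
        rw [← Real.rpow_add hb, ← Real.rpow_add hb]; congr 1; linarith
      rw [hP, h1, h2]; ring
    rw [L, R1, R2, ← mul_add, mul_left_comm] at hineq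
    exact le_of_mul_le_mul_left hineq hP0
  have lim : Tendsto (fun ρ : ℝ => C * (c2 * ρ ^ (-(k * (1/2 - 1/q))) +
      c3 * ρ ^ (-(k * (1 - 2 * (1/q)))))) atTop (nhds (C * (c2 * 0 + c3 * 0))) := by
    have t1 := tendsto_rpow_neg_atTop (y := k * (1/2 - 1/q)) (mul_pos hk0 (by linarith))
    have t2 := tendsto_rpow_neg_atTop (y := k * (1 - 2 * (1/q))) (mul_pos hk0 (by linarith))
    exact ((t1.const_mul c2).add (t2.const_mul c3)).const_mul C
  have := ge_of_tendsto lim (by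
    filter_upwards [eventually_ge_atTop 2, eventually_ge_atTop (8 * (n:ℝ))] with ρ h2 h8
    exact key ρ h2 h8)
  simp at this
  linarith
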